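/- arXiv:2304.08744 — 3 statements merged into one kernel-verified Lean document; each statement's English description precedes it below -/
import Mathlib

section
/- Let d ≥ 2 and k ≥ 1 be integers. Let (v_λ)_{λ>0} be positive reals with v_λ → ∞ and v_λ − (d−1)λ − (k−1) log λ → −∞ as λ → ∞, and set u_λ := e^{(d−1)λ} e^{−v_λ} v_λ^{k−1}/(d−1). Let (r_λ)_{λ>0} be positive reals for which there exist constants C₁ ≤ C₂ such that log(v_λ)/(d−1) + C₁ ≤ r_λ ≤ log(v_λ)/(d−1) + C₂ for all sufficiently large λ. For λ > 0 set S_λ := [0, u_λ^{−1/(d−1)}]^{d−1} ⊆ ℝ^{d−1}, Q_λ := S_λ × [e^{−λ},∞), and Q_λ^- := {(x,y) ∈ Q_λ : inf_{z ∈ ℝ^{d−1} ∖ S_λ} ‖x − z‖ ≥ y e^{r_λ}}. Then V_hyp(Q_λ ∖ Q_λ^-)/V_hyp(Q_λ) → 0 as λ → ∞, where V_hyp is the hyperbolic volume measure. -/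
open MeasureTheory Filter Set
open scoped ENNReal NNReal

noncomputable section

/-- Inverse hyperbolic cosine. -/
def arcoshR (x : ℝ) : ℝ := Real.log (x + Real.sqrt (x ^ 2 - 1))

/-- The half-space model of `d`-dimensional hyperbolic space, as the ambient
product `ℝ^{d-1} × ℝ` (the actual hyperbolic space is the part with positive
last coordinate). -/
abbrev Hyp (d : ℕ) := EuclideanSpace ℝ (Fin (d - 1)) × ℝ

/-- Hyperbolic distance in the half-space model. -/
def distHyp (d : ℕ) (z w : Hyp d) : ℝ :=
  arcoshR (1 + (‖z.1 - w.1‖ ^ 2 + (z.2 - w.2) ^ 2) / (2 * z.2 * w.2))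

/-- Closed hyperbolic ball of radius `r` around `z`. -/
def ballHyp (d : ℕ) (z : Hyp d) (r : ℝ) : Set (Hyp d) :=
  {w | 0 < w.2 ∧ distHyp d z w ≤ r}

/-- The upper half space `ℝ^{d-1} × (0,∞)`. -/
def upperHalf (d : ℕ) : Set (Hyp d) := {z | 0 < z.2}

/-- The hyperbolic volume measure: density `y^{-d}` w.r.t. Lebesgue measure on
`ℝ^{d-1} × (0,∞)`. -/
def volHyp (d : ℕ) : Measure (Hyp d) :=
  (volume.restrict (upperHalf d)).withDensity fun z => ENNReal.ofReal (z.2 ^ (-(d : ℤ)))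

/-- `u_λ = e^{(d-1)λ} e^{-v_λ} v_λ^{k-1} / (d-1)`. -/
def uScale (d k : ℕ) (v : ℝ → ℝ) (l : ℝ) : ℝ :=
  Real.exp ((d - 1 : ℝ) * l) / (d - 1 : ℝ) * Real.exp (-(v l)) * v l ^ (k - 1)

/-- The base cube `S_λ = [0, u_λ^{-1/(d-1)}]^{d-1} ⊆ ℝ^{d-1}`. -/
def baseCube (d k : ℕ) (v : ℝ → ℝ) (l : ℝ) : Set (EuclideanSpace ℝ (Fin (d - 1))) :=
  {x | ∀ i, x i ∈ Icc (0 : ℝ) ((uScale d k v l) ^ (-(((d : ℝ) - 1)⁻¹)))}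

/-- The block `Q_λ = S_λ × [e^{-λ}, ∞)`. -/
def blockQ (d k : ℕ) (v : ℝ → ℝ) (l : ℝ) : Set (Hyp d) :=
  {z | z.1 ∈ baseCube d k v l ∧ Real.exp (-l) ≤ z.2}

/-- The inner block `Q_λ⁻`: points `(x,y)` of `Q_λ` with
`inf_{z ∉ S_λ} ‖x - z‖ ≥ y e^{r_λ}`. -/
def blockQminus (d k : ℕ) (v : ℝ → ℝ) (r : ℝ → ℝ) (l : ℝ) : Set (Hyp d) :=
  {z | z ∈ blockQ d k v l ∧
    z.2 * Real.exp (r l) ≤ Metric.infDist z.1 (baseCube d k v l)ᶜ}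

lemma lintegral_Ici_zpow_neg (d : ℕ) (hd : 2 ≤ d) {b : ℝ} (hb : 0 < b) :
    ∫⁻ y in Ici b, ENNReal.ofReal (y ^ (-(d : ℤ))) =
      ENNReal.ofReal (((d - 1 : ℕ) : ℝ)⁻¹ * (b ^ (d - 1))⁻¹) := by
  have hd' : (2 : ℝ) ≤ d := by exact_mod_cast hd
  have hlt : -(d : ℝ) < -1 := by linarith
  have hcast : ((d - 1 : ℕ) : ℝ) = d - 1 := by
    rw [Nat.cast_sub (by omega), Nat.cast_one]
  have hpow : ∀ y : ℝ, y ^ (-(d : ℤ)) = y ^ (-(d : ℝ)) := fun y => by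
    rw [← Real.rpow_intCast]; push_cast; rfl
  simp_rw [hpow]
  rw [setLIntegral_congr Ioi_ae_eq_Ici.symm, ← ofReal_integral_eq_lintegral_ofReal
    (integrableOn_Ioi_rpow_of_lt hlt hb), integral_Ioi_rpow_of_lt hlt hb]
  · congr 1
    rw [← Real.rpow_natCast, ← Real.rpow_neg hb.le, hcast,
      show -(d : ℝ) + 1 = -(d - 1) by ring, neg_div_neg_eq]
    field_simp
  · filter_upwards [ae_restrict_mem measurableSet_Ioi] with y hy
    exact Real.rpow_nonneg (hb.trans hy).le _

lemma volHyp_prod_Ici (d : ℕ) (hd : 2 ≤ d) {A : Set (EuclideanSpace ℝ (Fin (d - 1)))}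
    (hA : MeasurableSet A) {b : ℝ} (hb : 0 < b) :
    volHyp d (A ×ˢ Ici b) =
      volume A * ENNReal.ofReal (((d - 1 : ℕ) : ℝ)⁻¹ * (b ^ (d - 1))⁻¹) := by
  have hsub : A ×ˢ Ici b ⊆ upperHalf d := fun z hz => hb.trans_le hz.2
  rw [volHyp, withDensity_apply _ (hA.prod measurableSet_Ici),
    Measure.restrict_restrict (hA.prod measurableSet_Ici), inter_eq_left.mpr hsub,
    Measure.volume_eq_prod, ← Measure.prod_restrict]
  have h := lintegral_prod_mul (μ := (volume : Measure (EuclideanSpace ℝ (Fin (d - 1)))).restrict A)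
    (ν := (volume : Measure ℝ).restrict (Ici b)) (f := fun _ => 1)
    (g := fun y => ENNReal.ofReal (y ^ (-(d : ℤ)))) (by fun_prop)
    (by exact (by measurability : Measurable _).aemeasurable)
  simp only [one_mul, lintegral_one, Measure.restrict_apply_univ] at h
  rw [h, lintegral_Ici_zpow_neg d hd hb]

/-- The closed coordinate box with corners `a` and `b`. -/
def coordBox {ι : Type*} (a b : ι → ℝ) : Set (EuclideanSpace ℝ ι) :=
  {x | ∀ i, x i ∈ Icc (a i) (b i)}

lemma measurableSet_coordBox {ι : Type*} [Fintype ι] (a b : ι → ℝ) :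
    MeasurableSet (coordBox a b) := by
  have : coordBox a b = (WithLp.ofLp : EuclideanSpace ℝ ι → ι → ℝ) ⁻¹' Icc a b := by
    ext x; simp [coordBox, Pi.le_def, forall_and]
  rw [this]
  exact (PiLp.volume_preserving_ofLp ι).measurable measurableSet_Icc

lemma volume_coordBox {ι : Type*} [Fintype ι] (a b : ι → ℝ) :
    volume (coordBox a b) = ∏ i, ENNReal.ofReal (b i - a i) := by
  have : coordBox a b = (WithLp.ofLp : EuclideanSpace ℝ ι → ι → ℝ) ⁻¹' Icc a b := by
    ext x; simp [coordBox, Pi.le_def, forall_and]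
  rw [this, (PiLp.volume_preserving_ofLp ι).measure_preimage measurableSet_Icc.nullMeasurableSet,
    Real.volume_Icc_pi]

lemma volume_coordBox_update {n : ℕ} (i : Fin n) {p q s : ℝ} (hpq : p ≤ q) (hs : 0 ≤ s) :
    volume (coordBox (Function.update (fun _ => 0) i p) (Function.update (fun _ => s) i q)) =
      ENNReal.ofReal ((q - p) * s ^ (n - 1)) := by
  rw [volume_coordBox, Fintype.prod_eq_mul_prod_compl i, Finset.prod_congr rfl
    (g := fun _ => ENNReal.ofReal s)]
  · rw [Finset.prod_const, Finset.card_compl, ENNReal.ofReal_mul (sub_nonneg.mpr hpq),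
      ENNReal.ofReal_pow hs]
    simp
  · intro j hj
    have : j ≠ i := by simpa using hj
    simp [this]

/-- A point of a cube at distance less than `δ` from the complement has a coordinate within `δ`
of an end of the edge interval. -/
lemma exists_coord_near_of_infDist_compl_lt {n : ℕ} (hn : 0 < n) {s δ : ℝ}
    {x : EuclideanSpace ℝ (Fin n)}
    (hδ : Metric.infDist x (coordBox (fun _ => 0) (fun _ => s))ᶜ < δ) :
    ∃ i, x i < δ ∨ s - δ < x i := by
  have hne : ((coordBox (fun _ => 0) (fun _ => s))ᶜ : Set (EuclideanSpace ℝ (Fin n))).Nonempty := by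
    refine ⟨WithLp.toLp 2 fun _ => -1, fun h => ?_⟩
    have := (h ⟨0, hn⟩).1
    norm_num at this
  obtain ⟨z, hz, hxz⟩ := (Metric.infDist_lt_iff hne).mp hδ
  obtain ⟨i, hi⟩ : ∃ i, z i ∉ Icc 0 s := by simpa [coordBox] using hz
  have habs : |x i - z i| < δ := by
    refine lt_of_le_of_lt ?_ hxz
    rw [dist_eq_norm]
    simpa using PiLp.norm_apply_le (x - z) i
  rw [abs_lt] at habs
  refine ⟨i, ?_⟩
  by_contra! h
  exact hi ⟨by linarith, by linarith⟩

lemma volHyp_cube_boundary_ratio_le (d : ℕ) (hd : 2 ≤ d) {s a R η : ℝ} (hs : 0 < s) (ha : 0 < a)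
    (hR : 0 < R) (hη : 0 < η) (hηR : η ^ 2 * s = a * R) :
    volHyp d (coordBox (fun _ => 0) (fun _ => s) ×ˢ Ici a \
        {z | z ∈ coordBox (fun _ => 0) (fun _ => s) ×ˢ Ici a ∧
          z.2 * R ≤ Metric.infDist z.1 (coordBox (fun _ => 0) (fun _ => s))ᶜ}) /
      volHyp d (coordBox (fun _ => 0) (fun _ => s) ×ˢ Ici a) ≤
    ENNReal.ofReal (η ^ (d - 1) + ((d - 1 : ℕ) : ℝ) * (2 * η)) := by
  set K : Set (EuclideanSpace ℝ (Fin (d - 1))) := coordBox (fun _ => 0) (fun _ => s) with hK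
  let E (i : Fin (d - 1)) (p q : ℝ) : Set (EuclideanSpace ℝ (Fin (d - 1))) :=
    coordBox (Function.update (fun _ => 0) i p) (Function.update (fun _ => s) i q)
  have hn : 0 < d - 1 := by omega
  have hn' : (0 : ℝ) < ((d - 1 : ℕ) : ℝ) := by exact_mod_cast hn
  have hT : 0 < a / η := by positivity
  have hsub : K ×ˢ Ici a \ {z | z ∈ K ×ˢ Ici a ∧ z.2 * R ≤ Metric.infDist z.1 Kᶜ} ⊆
      K ×ˢ Ici (a / η) ∪
        ⋃ i, (E i 0 (η * s) ×ˢ Ici a ∪ E i (s - η * s) s ×ˢ Ici a) := by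
    rintro z ⟨⟨hz1, hz2⟩, hz⟩
    have hlt : Metric.infDist z.1 Kᶜ < z.2 * R := by
      by_contra! h
      exact hz ⟨⟨hz1, hz2⟩, h⟩
    rcases le_or_gt (a / η) z.2 with h | h
    · exact Or.inl ⟨hz1, h⟩
    · have hδ : Metric.infDist z.1 Kᶜ < η * s := by
        refine hlt.trans ?_
        calc z.2 * R < a / η * R := by gcongr
          _ = η * s := by field_simp; linarith
      obtain ⟨i, hi⟩ := exists_coord_near_of_infDist_compl_lt hn hδ
      refine Or.inr (mem_iUnion.mpr ⟨i, ?_⟩)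
      have key : ∀ p q, p ≤ z.1 i → z.1 i ≤ q → z.1 ∈ E i p q := by
        intro p q hp hq j
        rcases eq_or_ne j i with rfl | hj
        · simpa using ⟨hp, hq⟩
        · simpa [hj] using hz1 j
      rcases hi with hi | hi
      · exact Or.inl ⟨key _ _ (hz1 i).1 hi.le, hz2⟩
      · exact Or.inr ⟨key _ _ hi.le (hz1 i).2, hz2⟩
  have hKvol : volume K = ENNReal.ofReal (s ^ (d - 1)) := by
    rw [hK, volume_coordBox, ENNReal.ofReal_pow hs.le]
    simp
  have hspow : s * s ^ (d - 1 - 1) = s ^ (d - 1) := by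
    rw [← pow_succ', Nat.sub_add_cancel hn]
  set c : ℝ := ((d - 1 : ℕ) : ℝ)⁻¹ * (a ^ (d - 1))⁻¹ with hc
  have hcpos : 0 < c := by positivity
  have hE : ∀ i p q, q - p = η * s →
      volHyp d (E i p q ×ˢ Ici a) = ENNReal.ofReal (η * (s ^ (d - 1) * c)) := by
    intro i p q hpq
    rw [volHyp_prod_Ici d hd (measurableSet_coordBox _ _) ha,
      volume_coordBox_update i (by nlinarith [mul_pos hη hs]) hs.le, hpq,
      ← ENNReal.ofReal_mul (by positivity), ← hspow]
    congr 1
    ring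
  have htop : volHyp d (K ×ˢ Ici (a / η)) = ENNReal.ofReal (η ^ (d - 1) * (s ^ (d - 1) * c)) := by
    rw [volHyp_prod_Ici d hd (measurableSet_coordBox _ _) hT, hKvol,
      ← ENNReal.ofReal_mul (by positivity), hc, div_pow]
    congr 1
    field_simp
  rw [volHyp_prod_Ici d hd (measurableSet_coordBox _ _) ha, hKvol,
    ← ENNReal.ofReal_mul (by positivity)]
  refine ENNReal.div_le_of_le_mul ?_
  rw [← ENNReal.ofReal_mul (by positivity)]
  calc _ ≤ volHyp d (K ×ˢ Ici (a / η)) +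
        ∑ i, (volHyp d (E i 0 (η * s) ×ˢ Ici a) + volHyp d (E i (s - η * s) s ×ˢ Ici a)) := by
        refine (measure_mono hsub).trans ((measure_union_le _ _).trans ?_)
        gcongr
        refine (measure_iUnion_le _).trans ?_
        rw [tsum_fintype]
        gcongr
        exact measure_union_le _ _
    _ = ENNReal.ofReal ((η ^ (d - 1) + ((d - 1 : ℕ) : ℝ) * (2 * η)) * (s ^ (d - 1) * c)) := by
        simp_rw [htop, fun i => hE i 0 (η * s) (by ring), fun i => hE i (s - η * s) s (by ring)]
        rw [Finset.sum_const, Finset.card_univ, Fintype.card_fin, nsmul_eq_mul,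
          ← ENNReal.ofReal_natCast, ← ENNReal.ofReal_add (by positivity) (by positivity),
          ← ENNReal.ofReal_mul (by positivity),
          ← ENNReal.ofReal_add (by positivity) (by positivity)]
        congr 1
        ring

lemma uScale_pos {d : ℕ} (hd : 2 ≤ d) (k : ℕ) {v : ℝ → ℝ} {l : ℝ} (hv : 0 < v l) :
    0 < uScale d k v l := by
  have : (2 : ℝ) ≤ d := by exact_mod_cast hd
  have : (0 : ℝ) < d - 1 := by linarith
  unfold uScale
  positivity

/-- The scale of the excluded boundary layer at the bottom of the block, relative to the side
length of the base cube, tends to zero. -/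
lemma tendsto_relative_layer_width {d k : ℕ} (hd : 2 ≤ d) (hk : 1 ≤ k) {v r : ℝ → ℝ}
    (hv_div : Tendsto v atTop atTop) {C : ℝ}
    (hr : ∀ᶠ l in atTop, r l ≤ Real.log (v l) / (d - 1 : ℝ) + C) :
    Tendsto (fun l => Real.exp (-l) * Real.exp (r l) /
      uScale d k v l ^ (-(((d : ℝ) - 1)⁻¹))) atTop (nhds 0) := by
  have hd' : (2 : ℝ) ≤ d := by exact_mod_cast hd
  have hm : (0 : ℝ) < d - 1 := by linarith
  set m : ℝ := (d : ℝ) - 1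
  have hlim : Tendsto (fun l => Real.exp C * (m⁻¹ * (v l ^ k * Real.exp (-(v l)))) ^ m⁻¹)
      atTop (nhds 0) := by
    have h1 := ((Real.tendsto_pow_mul_exp_neg_atTop_nhds_zero k).comp hv_div).const_mul m⁻¹
    have h2 := (h1.rpow_const (p := m⁻¹) (Or.inr (by positivity))).const_mul (Real.exp C)
    simpa [Real.zero_rpow (inv_pos.mpr hm).ne'] using h2
  refine tendsto_of_tendsto_of_tendsto_of_le_of_le' tendsto_const_nhds hlim ?_ ?_
  · filter_upwards [hv_div.eventually_gt_atTop 0] with l hv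
    have := uScale_pos hd k hv
    positivity
  · filter_upwards [hv_div.eventually_gt_atTop 0, hr] with l hv hrl
    have hu := uScale_pos hd k hv
    have hexp : Real.exp (-l) = Real.exp (-(m * l)) ^ m⁻¹ := by
      rw [← Real.exp_mul]; congr 1; field_simp
    have hlog : Real.exp (Real.log (v l) / m + C) = Real.exp C * v l ^ m⁻¹ := by
      rw [Real.exp_add, mul_comm, Real.rpow_def_of_pos hv, div_eq_mul_inv]
    calc Real.exp (-l) * Real.exp (r l) / uScale d k v l ^ (-m⁻¹)
        ≤ Real.exp (-l) * Real.exp (Real.log (v l) / m + C) / uScale d k v l ^ (-m⁻¹) := by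
          gcongr
      _ = Real.exp C * (Real.exp (-(m * l)) * v l * uScale d k v l) ^ m⁻¹ := by
          rw [hlog, hexp, Real.rpow_neg hu.le, div_inv_eq_mul,
            Real.mul_rpow (by positivity) hu.le, Real.mul_rpow (by positivity) hv.le]
          ring
      _ = Real.exp C * (m⁻¹ * (v l ^ k * Real.exp (-(v l)))) ^ m⁻¹ := by
          congr 2
          have : v l ^ k = v l * v l ^ (k - 1) := by
            rw [← pow_succ', Nat.sub_add_cancel hk]
          rw [this, uScale, Real.exp_neg (m * l)]
          change (Real.exp (m * l))⁻¹ * v l *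
            (Real.exp (m * l) / m * Real.exp (-(v l)) * v l ^ (k - 1)) = _
          field_simp

/-- **Negligibility of the boundary part of a block.**
If `r_λ = log(v_λ)/(d-1) + O(1)`, then `V_hyp(Q_λ ∖ Q_λ⁻)/V_hyp(Q_λ) → 0`. -/
theorem blockQminus_volume_ratio (d k : ℕ) (hd : 2 ≤ d) (hk : 1 ≤ k)
    (v : ℝ → ℝ) (hv_pos : ∀ l, 0 < l → 0 < v l)
    (hv_div : Filter.Tendsto v atTop atTop)
    (hv_thresh : Filter.Tendsto
      (fun l => v l - (d - 1 : ℝ) * l - (k - 1 : ℝ) * Real.log l) atTop atBot)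
    (r : ℝ → ℝ) (hr_pos : ∀ l, 0 < l → 0 < r l) (C₁ C₂ : ℝ) (hC : C₁ ≤ C₂)
    (hr_bound : ∀ᶠ l in atTop,
      Real.log (v l) / (d - 1 : ℝ) + C₁ ≤ r l ∧ r l ≤ Real.log (v l) / (d - 1 : ℝ) + C₂) :
    Filter.Tendsto
      (fun l => volHyp d (blockQ d k v l \ blockQminus d k v r l) / volHyp d (blockQ d k v l))
      atTop (nhds 0) := by
  have hn : d - 1 ≠ 0 := by omega
  set s : ℝ → ℝ := fun l => uScale d k v l ^ (-(((d : ℝ) - 1)⁻¹)) with hs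
  set η : ℝ → ℝ := fun l => √(Real.exp (-l) * Real.exp (r l) / s l) with hη
  have hη0 : Tendsto η atTop (nhds 0) := by
    simpa using (tendsto_relative_layer_width hd hk hv_div (hr_bound.mono fun _ h => h.2)).sqrt
  have hlim : Tendsto
      (fun l => ENNReal.ofReal (η l ^ (d - 1) + ((d - 1 : ℕ) : ℝ) * (2 * η l)))
      atTop (nhds 0) := by
    have h := (hη0.pow (d - 1)).add ((hη0.const_mul 2).const_mul ((d - 1 : ℕ) : ℝ))
    simpa [hn] using ENNReal.tendsto_ofReal h
  refine tendsto_of_tendsto_of_tendsto_of_le_of_le' tendsto_const_nhds hlim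
    (Eventually.of_forall fun _ => zero_le) ?_
  filter_upwards [hv_div.eventually_gt_atTop 0] with l hv
  have hspos : 0 < s l := Real.rpow_pos_of_pos (uScale_pos hd k hv) _
  refine volHyp_cube_boundary_ratio_le d hd hspos (Real.exp_pos (-l)) (Real.exp_pos (r l))
    (Real.sqrt_pos.mpr (by positivity)) ?_
  rw [Real.sq_sqrt (by positivity), div_mul_cancel₀ _ hspos.ne']

end
end

section
/- Let d ≥ 2 be an integer and let 0 < ρ ≤ r. For all z₁, z₂ ∈ ℍ^d with dist_hyp(z₁,z₂) ≥ r, one has V_hyp(B_ρ(z₁) ∖ B_r(z₂)) ≥ V_hyp(B_ρ(z₁))/2. -/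
open MeasureTheory Filter Set
open scoped ENNReal NNReal

noncomputable section

/-- The hyperbolic cosine of the hyperbolic distance in the half-space model. -/
def coshDist (d : ℕ) (z w : Hyp d) : ℝ :=
  1 + (‖z.1 - w.1‖ ^ 2 + (z.2 - w.2) ^ 2) / (2 * z.2 * w.2)

lemma distHyp_eq_arcosh (d : ℕ) (z w : Hyp d) : distHyp d z w = Real.arcosh (coshDist d z w) :=
  rfl

lemma one_le_coshDist {d : ℕ} {z w : Hyp d} (hz : 0 < z.2) (hw : 0 < w.2) :
    1 ≤ coshDist d z w := by
  have : 0 ≤ (‖z.1 - w.1‖ ^ 2 + (z.2 - w.2) ^ 2) / (2 * z.2 * w.2) := by positivity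
  unfold coshDist
  linarith

lemma eq_of_coshDist_le_one {d : ℕ} {z w : Hyp d} (hz : 0 < z.2) (hw : 0 < w.2)
    (h : coshDist d z w ≤ 1) : w = z := by
  have h1 : (‖z.1 - w.1‖ ^ 2 + (z.2 - w.2) ^ 2) / (2 * z.2 * w.2) ≤ 0 := by
    unfold coshDist at h
    linarith
  rw [div_le_iff₀ (by positivity), zero_mul] at h1
  have hx : ‖z.1 - w.1‖ = 0 := by nlinarith [sq_nonneg ‖z.1 - w.1‖, sq_nonneg (z.2 - w.2)]
  have hy : z.2 - w.2 = 0 := by nlinarith [sq_nonneg ‖z.1 - w.1‖, sq_nonneg (z.2 - w.2)]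
  exact Prod.ext (sub_eq_zero.1 (norm_eq_zero.1 hx)).symm (sub_eq_zero.1 hy).symm

lemma coshDist_eq {d : ℕ} {z w : Hyp d} (hz : 0 < z.2) (hw : 0 < w.2) :
    coshDist d z w = (‖z.1 - w.1‖ ^ 2 + z.2 ^ 2 + w.2 ^ 2) / (2 * z.2 * w.2) := by
  unfold coshDist
  field_simp
  ring

lemma distHyp_le_distHyp {d : ℕ} {a b u v : Hyp d} (ha : 0 < a.2) (hb : 0 < b.2)
    (hu : 0 < u.2) (hv : 0 < v.2) :
    distHyp d a b ≤ distHyp d u v ↔ coshDist d a b ≤ coshDist d u v :=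
  Real.arcosh_le_arcosh (zero_lt_one.trans_le (one_le_coshDist ha hb))
    (zero_lt_one.trans_le (one_le_coshDist hu hv))

lemma measurableSet_upperHalf (d : ℕ) : MeasurableSet (upperHalf d) :=
  measurableSet_lt measurable_const measurable_snd

lemma measurableSet_ballHyp (d : ℕ) (z : Hyp d) (r : ℝ) : MeasurableSet (ballHyp d z r) := by
  have h : Measurable (distHyp d z) := by
    unfold distHyp arcoshR
    fun_prop
  exact (measurableSet_upperHalf d).inter (measurableSet_le h measurable_const)

lemma ballHyp_subset_upperHalf (d : ℕ) (z : Hyp d) (r : ℝ) : ballHyp d z r ⊆ upperHalf d :=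
  fun _ hw => hw.1

lemma volHyp_apply {d : ℕ} {s : Set (Hyp d)} (hs : MeasurableSet s) (hsu : s ⊆ upperHalf d) :
    volHyp d s = ∫⁻ z in s, ENNReal.ofReal (z.2 ^ (-(d : ℤ))) := by
  rw [volHyp, withDensity_apply _ hs, Measure.restrict_restrict_of_subset hsu]

lemma volHyp_singleton (d : ℕ) (z : Hyp d) : volHyp d {z} = 0 := by
  have hvol : (volume : Measure (Hyp d)) {z} = 0 := by
    rw [← Set.singleton_prod_singleton (a := z.1) (b := z.2), Measure.volume_eq_prod,
      Measure.prod_prod, Real.volume_singleton, mul_zero]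
  have : (volume.restrict (upperHalf d)) {z} = 0 :=
    Measure.absolutelyContinuous_of_le Measure.restrict_le_self hvol
  exact withDensity_absolutelyContinuous _ _ this

/-- The geodesic symmetry of the half-space model at the point `c`. -/
def pointReflection (d : ℕ) (c p : Hyp d) : Hyp d :=
  (c.1 - (c.2 ^ 2 / (‖p.1 - c.1‖ ^ 2 + p.2 ^ 2)) • (p.1 - c.1),
    c.2 ^ 2 / (‖p.1 - c.1‖ ^ 2 + p.2 ^ 2) * p.2)

section pointReflection

variable {d : ℕ} {c p : Hyp d}

lemma pointReflection_snd_pos (hc : 0 < c.2) (hp : 0 < p.2) :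
    0 < (pointReflection d c p).2 := by
  unfold pointReflection
  positivity

lemma pointReflection_pointReflection (hc : 0 < c.2) (hp : 0 < p.2) :
    pointReflection d c (pointReflection d c p) = p := by
  have hN : 0 < ‖p.1 - c.1‖ ^ 2 + p.2 ^ 2 := by positivity
  have hk : 0 < c.2 ^ 2 / (‖p.1 - c.1‖ ^ 2 + p.2 ^ 2) := by positivity
  have key : c.2 ^ 2 / (‖(pointReflection d c p).1 - c.1‖ ^ 2 + (pointReflection d c p).2 ^ 2)
      * (c.2 ^ 2 / (‖p.1 - c.1‖ ^ 2 + p.2 ^ 2)) = 1 := by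
    simp only [pointReflection, sub_sub_cancel_left, norm_neg, norm_smul, Real.norm_eq_abs,
      abs_of_pos hk]
    field_simp
  refine Prod.ext ?_ ?_
  · change c.1 - _ • ((pointReflection d c p).1 - c.1) = p.1
    conv_lhs =>
      enter [2, 2]
      simp only [pointReflection, sub_sub_cancel_left]
    rw [smul_neg, smul_smul, key, one_smul]
    abel
  · change _ * (_ * p.2) = p.2
    rw [← mul_assoc]
    exact (congrArg (· * p.2) key).trans (one_mul _)

lemma injOn_pointReflection (hc : 0 < c.2) : InjOn (pointReflection d c) (upperHalf d) :=
  fun p hp q hq h => by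
    rw [← pointReflection_pointReflection hc hp, h, pointReflection_pointReflection hc hq]

/-- The hyperbolic median identity. -/
lemma coshDist_add_coshDist_pointReflection (hc : 0 < c.2) (hp : 0 < p.2) {q : Hyp d}
    (hq : 0 < q.2) :
    coshDist d q p + coshDist d q (pointReflection d c p)
      = 2 * coshDist d c p * coshDist d c q := by
  rw [coshDist_eq hq hp, coshDist_eq hq (pointReflection_snd_pos hc hp), coshDist_eq hc hp,
    coshDist_eq hc hq]
  obtain ⟨u, hu⟩ : ∃ u, u = p.1 - c.1 := ⟨_, rfl⟩
  obtain ⟨v, hv⟩ : ∃ v, v = q.1 - c.1 := ⟨_, rfl⟩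
  have e1 : q.1 - p.1 = v - u := by rw [hu, hv]; abel
  have e2 : c.1 - p.1 = -u := by rw [hu]; abel
  have e3 : c.1 - q.1 = -v := by rw [hv]; abel
  have e4 (k : ℝ) : q.1 - (c.1 - k • u) = v + k • u := by rw [hv]; abel
  simp only [pointReflection, ← hu, e1, e2, e3, e4, norm_neg]
  rw [norm_sub_sq_real, norm_add_sq_real, norm_smul, inner_smul_right, mul_pow, Real.norm_eq_abs,
    sq_abs]
  field_simp
  ring

lemma coshDist_pointReflection (hc : 0 < c.2) (hp : 0 < p.2) :
    coshDist d c (pointReflection d c p) = coshDist d c p := by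
  have h := coshDist_add_coshDist_pointReflection hc hp hc
  have hcc : coshDist d c c = 1 := by simp [coshDist]
  rw [hcc] at h
  linarith

/-- The derivative of the geodesic symmetry, as a scaled reflection in the Euclidean structure
followed by a reflection in the vertical axis. -/
lemma exists_hasFDerivAt_pointReflection (hd : 1 ≤ d) (hp : 0 < p.2) :
    ∃ f' : Hyp d →L[ℝ] Hyp d, HasFDerivAt (pointReflection d c) f' p ∧
      |f'.det| = (c.2 ^ 2 / (‖p.1 - c.1‖ ^ 2 + p.2 ^ 2)) ^ d := by
  let e := WithLp.prodContinuousLinearEquiv 2 ℝ (EuclideanSpace ℝ (Fin (d - 1))) ℝ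
  let o : WithLp 2 (Hyp d) := e.symm (c.1, 0)
  have hN : ‖e.symm p - o‖ ^ 2 = ‖p.1 - c.1‖ ^ 2 + p.2 ^ 2 := by
    rw [WithLp.prod_norm_sq_eq_of_L2]
    simp [e, o]
  have hpo : e.symm p ≠ o := by
    intro h
    rw [h, sub_self, norm_zero] at hN
    have : 0 < p.2 ^ 2 := by positivity
    nlinarith [sq_nonneg ‖p.1 - c.1‖]
  let T : Hyp d →L[ℝ] Hyp d :=
    (-ContinuousLinearMap.id ℝ (EuclideanSpace ℝ (Fin (d - 1)))).prodMap
      (ContinuousLinearMap.id ℝ ℝ)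
  let D : WithLp 2 (Hyp d) →L[ℝ] WithLp 2 (Hyp d) :=
    (c.2 / dist (e.symm p) o) ^ 2 • ((ℝ ∙ (e.symm p - o))ᗮ.reflection :
      WithLp 2 (Hyp d) →L[ℝ] WithLp 2 (Hyp d))
  have hD : HasFDerivAt (EuclideanGeometry.inversion o c.2) D (e.symm p) :=
    EuclideanGeometry.hasFDerivAt_inversion hpo
  have hscale : (c.2 / dist (e.symm p) o) ^ 2 = c.2 ^ 2 / (‖p.1 - c.1‖ ^ 2 + p.2 ^ 2) := by
    rw [dist_eq_norm, div_pow, hN]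
  refine ⟨T ∘L ((e : WithLp 2 (Hyp d) →L[ℝ] Hyp d) ∘L D ∘L
    (e.symm : Hyp d →L[ℝ] WithLp 2 (Hyp d))), ?_, ?_⟩
  · have hcomp : HasFDerivAt
        (fun q => T (e (EuclideanGeometry.inversion o c.2 (e.symm q))) + ((2 : ℝ) • c.1, (0 : ℝ)))
        (T ∘L ((e : WithLp 2 (Hyp d) →L[ℝ] Hyp d) ∘L D ∘L
          (e.symm : Hyp d →L[ℝ] WithLp 2 (Hyp d)))) p :=
      (T.hasFDerivAt.comp p (e.hasFDerivAt.comp p (hD.comp p e.symm.hasFDerivAt))).add_const _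
    convert hcomp using 1
    funext q
    have hNq : ‖e.symm q - o‖ ^ 2 = ‖q.1 - c.1‖ ^ 2 + q.2 ^ 2 := by
      rw [WithLp.prod_norm_sq_eq_of_L2]
      simp [e, o]
    rw [EuclideanGeometry.inversion, dist_eq_norm, div_pow, hNq]
    refine Prod.ext ?_ ?_
    · simp [pointReflection, T, e, o, two_smul]
      abel
    · simp [pointReflection, T, e, o]
  · have hT : |LinearMap.det (T : Hyp d →ₗ[ℝ] Hyp d)| = 1 := by
      change |LinearMap.det ((-LinearMap.id : EuclideanSpace ℝ (Fin (d - 1)) →ₗ[ℝ] _).prodMap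
        (LinearMap.id : ℝ →ₗ[ℝ] ℝ))| = 1
      rw [LinearMap.det_prodMap, ← neg_one_smul ℝ LinearMap.id, LinearMap.det_smul]
      simp
    have hfin : Module.finrank ℝ (WithLp 2 (Hyp d)) = d := by
      rw [e.toLinearEquiv.finrank_eq, Module.finrank_prod]
      simp
      omega
    have hconj : LinearMap.det (((e : WithLp 2 (Hyp d) →L[ℝ] Hyp d) ∘L D ∘L
        (e.symm : Hyp d →L[ℝ] WithLp 2 (Hyp d)) : Hyp d →L[ℝ] Hyp d) : Hyp d →ₗ[ℝ] Hyp d) =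
        LinearMap.det (D : WithLp 2 (Hyp d) →ₗ[ℝ] WithLp 2 (Hyp d)) :=
      LinearMap.det_conj (D : WithLp 2 (Hyp d) →ₗ[ℝ] WithLp 2 (Hyp d)) e.toLinearEquiv
    rw [ContinuousLinearMap.det, ContinuousLinearMap.toLinearMap_comp, LinearMap.det_comp, abs_mul,
      hT, one_mul, hconj]
    change |LinearMap.det ((c.2 / dist (e.symm p) o) ^ 2 •
      ((ℝ ∙ (e.symm p - o))ᗮ.reflection.toLinearMap))| = _
    rw [LinearMap.det_smul, Submodule.det_reflection, hfin, hscale, abs_mul, abs_pow, abs_pow]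
    simp only [abs_neg, abs_one, one_pow, mul_one]
    rw [abs_of_nonneg (by positivity)]

lemma volHyp_image_pointReflection (hd : 1 ≤ d) (hc : 0 < c.2) {s : Set (Hyp d)}
    (hs : MeasurableSet s) (hsu : s ⊆ upperHalf d) :
    volHyp d (pointReflection d c '' s) = volHyp d s := by
  choose! f' hf' hdet using fun (p : Hyp d) (hp : 0 < p.2) =>
    exists_hasFDerivAt_pointReflection (c := c) hd hp
  have hderiv : ∀ x ∈ s, HasFDerivWithinAt (pointReflection d c) (f' x) s x :=
    fun x hx => (hf' x (hsu hx)).hasFDerivWithinAt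
  have hinj : InjOn (pointReflection d c) s := (injOn_pointReflection hc).mono hsu
  have himg : pointReflection d c '' s ⊆ upperHalf d := by
    rintro _ ⟨x, hx, rfl⟩
    exact pointReflection_snd_pos hc (hsu hx)
  have : (volume : Measure (Hyp d)).IsAddHaarMeasure := by
    rw [Measure.volume_eq_prod]
    infer_instance
  rw [volHyp_apply (measurable_image_of_fderivWithin hs hderiv hinj) himg, volHyp_apply hs hsu,
    lintegral_image_eq_lintegral_abs_det_fderiv_mul volume hs hderiv hinj]
  refine setLIntegral_congr_fun hs fun x hx => ?_
  have hx0 : 0 < x.2 := hsu hx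
  have hk : 0 < c.2 ^ 2 / (‖x.1 - c.1‖ ^ 2 + x.2 ^ 2) := by positivity
  rw [hdet x hx0, ← ENNReal.ofReal_mul (by positivity)]
  simp only [pointReflection]
  rw [mul_zpow, zpow_neg, zpow_natCast, mul_inv_cancel_left₀ (by positivity)]

end pointReflection

/-- **Half of a small ball lies outside a distant large ball.** If
`0 < ρ ≤ r ≤ dist_hyp(z₁,z₂)`, then at least half the volume of `B_ρ(z₁)` lies
outside `B_r(z₂)`. -/
theorem half_ball_volume_outside (d : ℕ) (hd : 2 ≤ d) (ρ r : ℝ)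
    (hρ : 0 < ρ) (hρr : ρ ≤ r) (z₁ z₂ : Hyp d) (h₁ : 0 < z₁.2) (h₂ : 0 < z₂.2)
    (hdist : r ≤ distHyp d z₁ z₂) :
    volHyp d (ballHyp d z₁ ρ) / 2 ≤ volHyp d (ballHyp d z₁ ρ \ ballHyp d z₂ r) := by
  set B := ballHyp d z₁ ρ
  set C := ballHyp d z₂ r
  have hB : MeasurableSet B := measurableSet_ballHyp d z₁ ρ
  have hC : MeasurableSet C := measurableSet_ballHyp d z₂ r
  have hsub : pointReflection d z₁ '' (B ∩ C) ⊆ B \ C ∪ {z₁} := by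
    rintro _ ⟨w, ⟨⟨hw, hwB⟩, -, hwC⟩, rfl⟩
    have hSw := pointReflection_snd_pos h₁ hw
    have hSB : pointReflection d z₁ w ∈ B := by
      refine ⟨hSw, ?_⟩
      rwa [distHyp_eq_arcosh, coshDist_pointReflection h₁ hw, ← distHyp_eq_arcosh]
    by_cases hSC : pointReflection d z₁ w ∈ C
    · right
      have hw' := (distHyp_le_distHyp h₂ hw h₁ h₂).1 (hwC.trans hdist)
      have hSw' := (distHyp_le_distHyp h₂ hSw h₁ h₂).1 (hSC.2.trans hdist)
      have hmed := coshDist_add_coshDist_pointReflection h₁ hw h₂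
      have hpos := one_le_coshDist h₁ h₂
      refine eq_of_coshDist_le_one h₁ hSw ?_
      rw [coshDist_pointReflection h₁ hw]
      nlinarith
    · exact Or.inl ⟨hSB, hSC⟩
  have hle : volHyp d (B ∩ C) ≤ volHyp d (B \ C) := by
    calc volHyp d (B ∩ C) = volHyp d (pointReflection d z₁ '' (B ∩ C)) :=
          (volHyp_image_pointReflection (by omega) h₁ (hB.inter hC)
            (inter_subset_left.trans (ballHyp_subset_upperHalf d z₁ ρ))).symm
      _ ≤ volHyp d (B \ C ∪ {z₁}) := measure_mono hsub
      _ ≤ volHyp d (B \ C) + volHyp d {z₁} := measure_union_le _ _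
      _ = volHyp d (B \ C) := by rw [volHyp_singleton, add_zero]
  refine ENNReal.div_le_of_le_mul ?_
  rw [mul_two, ← measure_inter_add_sdiff B hC]
  gcongr

end
end

section
/- Let k ≥ 1 be an integer and s₀ ∈ ℝ. Let (v_λ)_{λ>0} and (A_λ)_{λ>0} be families of positive reals such that v_λ → ∞ and A_λ e^{−v_λ} v_λ^{k−1} → 1 as λ → ∞. Then ∫_{s₀}^{∞} | A_λ e^{−(u+v_λ)} (u+v_λ)^{k−1}/(k−1)! − e^{−u}/(k−1)! | du → 0 as λ → ∞. -/
open Set Filter MeasureTheory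

theorem integrableOn_exp_neg_mul_one_add_abs_pow (n : ℕ) (a : ℝ) :
    IntegrableOn (fun u : ℝ => Real.exp (-u) * (1 + |u|) ^ n) (Ioi a) := by
  refine integrable_of_isBigO_exp_neg (b := 1 / 2) (by norm_num) (by fun_prop) ?_
  have h₁ : (fun u : ℝ => 1 + |u|) =O[atTop] fun u : ℝ => u := by
    refine Asymptotics.IsBigO.of_bound 2 ?_
    filter_upwards [eventually_ge_atTop 1] with u hu
    rw [Real.norm_eq_abs, Real.norm_eq_abs, abs_of_nonneg (by positivity)]
    have := le_abs_self u
    linarith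
  have h₂ : (fun u : ℝ => (1 + |u|) ^ n) =O[atTop] fun u => Real.exp (1 / 2 * u) :=
    (h₁.pow n).trans (isLittleO_pow_exp_pos_mul_atTop n one_half_pos).isBigO
  refine ((Asymptotics.isBigO_refl (fun u : ℝ => Real.exp (-u)) atTop).mul h₂).congr_right ?_
  intro u
  rw [← Real.exp_add]
  ring_nf

theorem mul_exp_neg_add_mul_add_pow (n : ℕ) (A u : ℝ) {v : ℝ} (hv : v ≠ 0) :
    A * Real.exp (-(u + v)) * (u + v) ^ n =
      A * Real.exp (-v) * v ^ n * (Real.exp (-u) * (1 + u / v) ^ n) := by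
  have h : u + v = v * (1 + u / v) := by field_simp; ring
  rw [neg_add, Real.exp_add, h, mul_pow]
  ring

/-- **L¹ convergence of the exceedance intensity density to the limit density.**
If `v_λ → ∞` and `A_λ e^{-v_λ} v_λ^{k-1} → 1`, then
`∫_{s₀}^∞ |A_λ e^{-(u+v_λ)}(u+v_λ)^{k-1}/(k-1)! - e^{-u}/(k-1)!| du → 0`. -/
theorem intensity_density_L1_convergence (k : ℕ) (hk : 1 ≤ k) (s₀ : ℝ)
    (v A : ℝ → ℝ) (hv_pos : ∀ l, 0 < l → 0 < v l) (hA_pos : ∀ l, 0 < l → 0 < A l)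
    (hv : Tendsto v atTop atTop)
    (hA : Tendsto (fun l => A l * Real.exp (-(v l)) * v l ^ (k - 1)) atTop (nhds 1)) :
    Tendsto (fun l => ∫ u in Ioi s₀,
        |A l * Real.exp (-(u + v l)) * (u + v l) ^ (k - 1) / (k - 1).factorial
          - Real.exp (-u) / (k - 1).factorial|) atTop (nhds 0) := by
  generalize k - 1 = n at hA ⊢
  rw [← integral_zero ℝ ℝ (μ := volume.restrict (Ioi s₀))]
  refine tendsto_integral_filter_of_dominated_convergence
    (fun u => 3 * (Real.exp (-u) * (1 + |u|) ^ n)) ?_ ?_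
    ((integrableOn_exp_neg_mul_one_add_abs_pow n s₀).const_mul 3) ?_
  · exact .of_forall fun l => Continuous.aestronglyMeasurable (by fun_prop)
  · filter_upwards [hv.eventually_ge_atTop 1, hA.eventually_le_const one_lt_two,
      hA.eventually_const_le (show (-2 : ℝ) < 1 by norm_num)] with l hl h₂ h₃
    refine .of_forall fun u => ?_
    rw [mul_exp_neg_add_mul_add_pow n _ _ (by positivity), ← sub_div, Real.norm_eq_abs, abs_abs,
      abs_div, Nat.abs_cast]
    refine (div_le_self (abs_nonneg _) (mod_cast n.factorial_pos)).trans ?_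
    generalize A l * Real.exp (-v l) * v l ^ n = c at h₂ h₃
    have hq : |1 + u / v l| ≤ 1 + |u| := by
      refine (abs_add_le _ _).trans ?_
      rw [abs_one, abs_div, abs_of_pos (zero_lt_one.trans_le hl)]
      gcongr
      exact div_le_self (abs_nonneg u) hl
    have h₁ : 1 ≤ (1 + |u|) ^ n := one_le_pow₀ (by simp)
    calc |c * (Real.exp (-u) * (1 + u / v l) ^ n) - Real.exp (-u)|
        ≤ |c * (Real.exp (-u) * (1 + u / v l) ^ n)| + |Real.exp (-u)| := abs_sub _ _
      _ = |c| * (Real.exp (-u) * |1 + u / v l| ^ n) + Real.exp (-u) * 1 := by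
        rw [abs_mul, abs_mul, abs_pow, Real.abs_exp, mul_one]
      _ ≤ 2 * (Real.exp (-u) * (1 + |u|) ^ n) + Real.exp (-u) * (1 + |u|) ^ n := by
        gcongr
        exact abs_le.2 ⟨h₃, h₂⟩
      _ = 3 * (Real.exp (-u) * (1 + |u|) ^ n) := by ring
  · refine .of_forall fun u => ?_
    have hq : Tendsto (fun l => 1 + u / v l) atTop (nhds 1) := by
      simpa using (hv.const_div_atTop u).const_add 1
    have h := (((hA.mul ((hq.pow n).const_mul (Real.exp (-u)))).div_const
      (n.factorial : ℝ)).sub_const (Real.exp (-u) / n.factorial)).abs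
    simp only [one_pow, mul_one, one_mul, sub_self, abs_zero] at h
    refine h.congr' ?_
    filter_upwards [hv.eventually_gt_atTop 0] with l hl
    rw [mul_exp_neg_add_mul_add_pow n _ _ hl.ne']
end
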